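/- Local o-minimality is preserved under elementary equivalence: if M and N are structures expanding dense linear orders without endpoints, M ≡ N, and M is locally o-minimal, then N is locally o-minimal. -/

import Mathlib

open FirstOrder FirstOrder.Language

universe u v w x

/-- A subset of a linear order is an open interval (possibly unbounded). -/
def IsOpenIntervalSet {M : Type w} [LinearOrder M] (s : Set M) : Prop :=
  (∃ a b : M, s = Set.Ioo a b) ∨ (∃ a : M, s = Set.Ioi a) ∨ (∃ b : M, s = Set.Iio b) ∨
    s = Set.univ

/-- `s` is a finite union of points and open intervals. -/
def IsFinUnionPointsIntervals {M : Type w} [LinearOrder M] (s : Set M) : Prop :=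
  ∃ (F : Finset M) (n : ℕ) (J : Fin n → Set M),
    (∀ k, IsOpenIntervalSet (J k)) ∧ s = ↑F ∪ ⋃ k, J k

/-- `M` is o-minimal: every subset of `M` definable with parameters is a finite union of
points and open intervals. -/
def IsOMinimal (L : FirstOrder.Language.{u, v}) (M : Type w) [L.Structure M]
    [LinearOrder M] : Prop :=
  ∀ s : Set M, (Set.univ : Set M).Definable₁ L s → IsFinUnionPointsIntervals s

/-- `M` is almost o-minimal: every bounded definable (with parameters) subset of `M` is a
finite union of points and open intervals. -/
def IsAlmostOMinimal (L : FirstOrder.Language.{u, v}) (M : Type w) [L.Structure M]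
    [LinearOrder M] : Prop :=
  ∀ s : Set M, (Set.univ : Set M).Definable₁ L s → BddAbove s → BddBelow s →
    IsFinUnionPointsIntervals s

/-- `M` is downward o-minimal: every definable (with parameters) subset of `M` that is
bounded above is a finite union of points and open intervals. -/
def IsDownwardOMinimal (L : FirstOrder.Language.{u, v}) (M : Type w) [L.Structure M]
    [LinearOrder M] : Prop :=
  ∀ s : Set M, (Set.univ : Set M).Definable₁ L s → BddAbove s → IsFinUnionPointsIntervals s

/-- `M` is upward o-minimal: every definable (with parameters) subset of `M` that is
bounded below is a finite union of points and open intervals. -/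
def IsUpwardOMinimal (L : FirstOrder.Language.{u, v}) (M : Type w) [L.Structure M]
    [LinearOrder M] : Prop :=
  ∀ s : Set M, (Set.univ : Set M).Definable₁ L s → BddBelow s → IsFinUnionPointsIntervals s

/-- `M` is locally o-minimal: for every definable set `D ⊆ M` and every `a ∈ M` there is
an open interval around `a` on which `D` is a finite union of points and open intervals. -/
def IsLocallyOMinimal (L : FirstOrder.Language.{u, v}) (M : Type w) [L.Structure M]
    [LinearOrder M] : Prop :=
  ∀ s : Set M, (Set.univ : Set M).Definable₁ L s → ∀ a : M,
    ∃ b c : M, b < a ∧ a < c ∧ IsFinUnionPointsIntervals (s ∩ Set.Ioo b c)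

open Filter in
/-- A finite union of points and open intervals is eventually constant along every filter which
decides all the cuts of the order. -/
theorem IsFinUnionPointsIntervals.eventuallyConst {M : Type w} [LinearOrder M] {s : Set M}
    (hs : IsFinUnionPointsIntervals s) {l : Filter M}
    (hlt : ∀ c, (∀ᶠ x in l, x < c) ∨ ∀ᶠ x in l, ¬x < c)
    (hgt : ∀ c, (∀ᶠ x in l, c < x) ∨ ∀ᶠ x in l, ¬c < x) :
    (∀ᶠ x in l, x ∈ s) ∨ ∀ᶠ x in l, x ∉ s := by
  obtain ⟨F, n, J, hJ, rfl⟩ := hs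
  by_cases hF : ∃ c ∈ F, ∀ᶠ x in l, x = c
  · obtain ⟨c, hc, h⟩ := hF
    exact .inl (h.mono fun x hx => .inl (hx ▸ hc))
  by_cases hn : ∃ k, ∀ᶠ x in l, x ∈ J k
  · obtain ⟨k, h⟩ := hn
    exact .inl (h.mono fun x hx => .inr (Set.mem_iUnion_of_mem k hx))
  have hF' : ∀ᶠ x in l, ∀ c ∈ F, x ≠ c := by
    refine (eventually_all_finset F).2 fun c hc => ?_
    rcases hlt c with h | h
    · exact h.mono fun x hx => hx.ne
    rcases hgt c with h' | h'
    · exact h'.mono fun x hx => hx.ne'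
    · exact absurd ((h.and h').mono fun x hx => le_antisymm (not_lt.1 hx.2) (not_lt.1 hx.1))
        fun h => hF ⟨c, hc, h⟩
  have hJ' : ∀ᶠ x in l, ∀ k, x ∉ J k := by
    refine eventually_all.2 fun k => ?_
    have hk : ¬∀ᶠ x in l, x ∈ J k := fun h => hn ⟨k, h⟩
    rcases hJ k with ⟨a, b, h⟩ | ⟨a, h⟩ | ⟨b, h⟩ | h <;> rw [h] at hk ⊢
    · rcases hgt a with ha | ha
      · rcases hlt b with hb | hb
        · exact absurd (ha.and hb) hk
        · exact hb.mono fun x hx hx' => hx hx'.2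
      · exact ha.mono fun x hx hx' => hx hx'.1
    · exact (hgt a).resolve_left hk
    · exact (hlt b).resolve_left hk
    · exact absurd (Eventually.of_forall fun x => Set.mem_univ x) hk
  refine .inr ((hF'.and hJ').mono fun x hx hx' => ?_)
  rcases hx' with h | h
  · exact hx.1 x h rfl
  · obtain ⟨k, hk⟩ := Set.mem_iUnion.1 h
    exact hx.2 k hk

/-- Immediately to the left of `a`, and immediately to the right of `a`, the set `s` is either
everything or nothing. -/
def HasConstantGerms {M : Type w} [LinearOrder M] (s : Set M) (a : M) : Prop :=
  ∃ b c, b < a ∧ a < c ∧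
    ((∀ x, b < x → x < a → x ∈ s) ∨ ∀ x, b < x → x < a → x ∉ s) ∧
    ((∀ x, a < x → x < c → x ∈ s) ∨ ∀ x, a < x → x < c → x ∉ s)

open Filter Topology in
theorem hasConstantGerms_iff {M : Type w} [LinearOrder M] [DenselyOrdered M] [NoMinOrder M]
    [NoMaxOrder M] {s : Set M} {a : M} :
    HasConstantGerms s a ↔
      ∃ b c : M, b < a ∧ a < c ∧ IsFinUnionPointsIntervals (s ∩ Set.Ioo b c) := by
  constructor
  · rintro ⟨b, c, hb, hc, hl, hr⟩
    refine ⟨b, c, hb, hc, (Set.toFinite (s ∩ {a})).toFinset, 2,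
      ![s ∩ Set.Ioo b a, s ∩ Set.Ioo a c], ?_, ?_⟩
    · have key : ∀ p q : M, ((∀ x, p < x → x < q → x ∈ s) ∨ ∀ x, p < x → x < q → x ∉ s) →
          IsOpenIntervalSet (s ∩ Set.Ioo p q) := by
        rintro p q (h | h)
        · exact .inl ⟨p, q, Set.inter_eq_right.2 fun x hx => h x hx.1 hx.2⟩
        · refine .inl ⟨p, p, ?_⟩
          rw [Set.Ioo_self]
          exact Set.eq_empty_of_forall_notMem fun x hx => h x hx.2.1 hx.2.2 hx.1
      exact Fin.forall_fin_two.2 ⟨key b a hl, key a c hr⟩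
    · ext x
      simp only [Set.mem_inter_iff, Set.mem_Ioo, Set.Finite.coe_toFinset, Set.mem_union,
        Set.mem_singleton_iff, Set.mem_iUnion, Fin.exists_fin_two, Matrix.cons_val_zero,
        Matrix.cons_val_one]
      grind
  · rintro ⟨b, c, hb, hc, hs⟩
    let := Preorder.topology M
    have : OrderTopology M := ⟨rfl⟩
    have hl := hs.eventuallyConst (l := 𝓝[<] a)
      (fun d => (le_or_gt a d).imp
        (fun h => eventually_mem_nhdsWithin.mono fun x hx => lt_of_lt_of_le hx h)
        fun h => mem_of_superset (Ioo_mem_nhdsLT h) fun x hx => hx.1.not_gt)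
      (fun d => (lt_or_ge d a).imp
        (fun h => mem_of_superset (Ioo_mem_nhdsLT h) fun x hx => hx.1)
        fun h => eventually_mem_nhdsWithin.mono fun x hx => (lt_of_lt_of_le hx h).not_gt)
    have hr := hs.eventuallyConst (l := 𝓝[>] a)
      (fun d => (lt_or_ge a d).imp
        (fun h => mem_of_superset (Ioo_mem_nhdsGT h) fun x hx => hx.2)
        fun h => eventually_mem_nhdsWithin.mono fun x hx => (lt_of_le_of_lt h hx).not_gt)
      (fun d => (le_or_gt d a).imp
        (fun h => eventually_mem_nhdsWithin.mono fun x hx => lt_of_le_of_lt h hx)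
        fun h => mem_of_superset (Ioo_mem_nhdsGT h) fun x hx => hx.2.not_gt)
    obtain ⟨b', hb', hl'⟩ : ∃ b' < a, (∀ x, b' < x → x < a → x ∈ s) ∨
        ∀ x, b' < x → x < a → x ∉ s := by
      rcases hl with h | h <;>
      obtain ⟨d, hd, hd'⟩ := (nhdsLT_basis a).eventually_iff.1 h <;>
      refine ⟨max b d, max_lt hb hd, ?_⟩
      · exact .inl fun x hx hxa => (hd' ⟨(le_max_right _ _).trans_lt hx, hxa⟩).1
      · exact .inr fun x hx hxa hxs => hd' ⟨(le_max_right _ _).trans_lt hx, hxa⟩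
          ⟨hxs, (le_max_left _ _).trans_lt hx, hxa.trans hc⟩
    obtain ⟨c', hc', hr'⟩ : ∃ c', a < c' ∧ ((∀ x, a < x → x < c' → x ∈ s) ∨
        ∀ x, a < x → x < c' → x ∉ s) := by
      rcases hr with h | h <;>
      obtain ⟨d, hd, hd'⟩ := (nhdsGT_basis a).eventually_iff.1 h <;>
      refine ⟨min c d, lt_min hc hd, ?_⟩
      · exact .inl fun x hxa hx => (hd' ⟨hxa, hx.trans_le (min_le_right _ _)⟩).1
      · exact .inr fun x hxa hx hxs => hd' ⟨hxa, hx.trans_le (min_le_right _ _)⟩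
          ⟨hxs, hb.trans hxa, hx.trans_le (min_le_left _ _)⟩
    exact ⟨b', c', hb', hc', hl', hr'⟩

namespace FirstOrder.Language

/-- A formula satisfied by some assignment in `M` is satisfied by some assignment in every nonempty
structure elementarily equivalent to `M`. -/
theorem ElementarilyEquivalent.exists_realize {L : Language.{u, v}} {M : Type w} {N : Type x}
    [L.Structure M] [L.Structure N] [Nonempty M] [Nonempty N] (h : M ≅[L] N) {α : Type*}
    {φ : L.Formula α} (hφ : ∃ v : α → M, φ.Realize v) : ∃ v : α → N, φ.Realize v := by
  classical
  have key := h.realize_sentence φ.exClosure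
  rw [← Formula.exists_realize_equivSentence_iff_realize_exClosure,
    ← Formula.exists_realize_equivSentence_iff_realize_exClosure] at key
  obtain ⟨v, hv⟩ := hφ
  obtain ⟨v', hv'⟩ := key.1 ⟨v, by
    let := constantsOn.structure v
    exact (Formula.realize_equivSentence M φ).2 hv⟩
  let := constantsOn.structure v'
  exact ⟨v', (Formula.realize_equivSentence N φ).1 hv'⟩

/-- The formula expressing that the set defined by `φ` in its last variable has constant one-sided
germs at the point named by that variable. -/
def Formula.constantGerms {L : Language.{u, v}} [L.IsOrdered] {α : Type*}
    (φ : L.Formula (α ⊕ Fin 1)) : L.Formula (α ⊕ Fin 1) :=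
  let a {n : ℕ} : L.Term ((α ⊕ Fin 1) ⊕ Fin n) := Term.var (.inl (.inr 0))
  let ψ : L.BoundedFormula (α ⊕ Fin 1) 3 :=
    BoundedFormula.relabel (n := 3) (k := 0) (Sum.elim (.inl ∘ .inl) fun _ => .inr 2) φ
  .ex (.ex ((&0).lt a ⊓ (a.lt &1 ⊓
    ((.all ((&0).lt &2 ⟹ ((&2).lt a ⟹ ψ)) ⊔ .all ((&0).lt &2 ⟹ ((&2).lt a ⟹ ∼ψ))) ⊓
      (.all (a.lt &2 ⟹ ((&2).lt &1 ⟹ ψ)) ⊔ .all (a.lt &2 ⟹ ((&2).lt &1 ⟹ ∼ψ)))))))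

theorem Formula.realize_constantGerms {L : Language.{u, v}} [L.IsOrdered] {M : Type w}
    [LinearOrder M] [L.Structure M] [L.OrderedStructure M] {α : Type*}
    {φ : L.Formula (α ⊕ Fin 1)} {v : α ⊕ Fin 1 → M} :
    φ.constantGerms.Realize v ↔
      HasConstantGerms {x | φ.Realize (Sum.elim (v ∘ .inl) fun _ => x)} (v (.inr 0)) := by
  have key : ∀ b c x : M, BoundedFormula.Realize
      (BoundedFormula.relabel (n := 3) (k := 0) (Sum.elim (.inl ∘ .inl) fun _ => .inr 2) φ) v
        (Fin.snoc (Fin.snoc (Fin.snoc default b) c) x : Fin 3 → M) ↔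
      φ.Realize (Sum.elim (v ∘ .inl) fun _ => x) := by
    intro b c x
    rw [BoundedFormula.realize_relabel, Formula.Realize, iff_iff_eq]
    congr 1
    · ext (i | i) <;> rfl
    · exact Subsingleton.elim _ _
  simp only [Formula.constantGerms, Formula.Realize, BoundedFormula.realize_ex,
    BoundedFormula.realize_inf, BoundedFormula.realize_sup, BoundedFormula.realize_all,
    BoundedFormula.realize_imp, BoundedFormula.realize_not, Term.realize_lt]
  simp only [key]
  rfl

theorem Formula.definable₁_setOf_realize {L : Language.{u, v}} {M : Type w} [L.Structure M]
    {α : Type*} (φ : L.Formula (α ⊕ Fin 1)) (v : α → M) :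
    (Set.univ : Set M).Definable₁ L {x | φ.Realize (Sum.elim v fun _ => x)} := by
  refine Set.definable_iff_exists_formula_sum.2
    ⟨φ.relabel (Sum.map (fun i => ⟨v i, Set.mem_univ _⟩) id), ?_⟩
  ext x
  simp only [Set.mem_ofPred_eq, Formula.realize_relabel, iff_iff_eq]
  congr 1
  ext (i | i)
  · rfl
  · exact congrArg x (Subsingleton.elim _ _)

end FirstOrder.Language

/-- Local o-minimality is preserved under elementary equivalence: if
`M` and `N` are structures expanding dense linear orders without endpoints, `M ≡ N`, and
`M` is locally o-minimal, then `N` is locally o-minimal. -/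
theorem locally_ominimal_of_elementarily_equivalent
    {L : FirstOrder.Language.{u, v}} [L.IsOrdered] {M : Type w}
    [LinearOrder M] [L.Structure M] [L.OrderedStructure M]
    [DenselyOrdered M] [NoMinOrder M] [NoMaxOrder M]
    {N : Type x} [LinearOrder N] [L.Structure N] [L.OrderedStructure N]
    [DenselyOrdered N] [NoMinOrder N] [NoMaxOrder N]
    (heq : M ≅[L] N) (hloc : IsLocallyOMinimal L M) :
    IsLocallyOMinimal L N := by
  intro s hs a
  rw [← hasConstantGerms_iff]
  obtain ⟨φ, hφ⟩ := Set.definable_iff_exists_formula_sum.1 hs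
  have hφs : s = {x | φ.Realize (Sum.elim (↑) fun _ => x)} :=
    Set.ext fun x => Set.ext_iff.1 hφ fun _ => x
  have : Nonempty N := ⟨a⟩
  have : Nonempty M := heq.nonempty_iff.2 ‹_›
  by_contra hN
  obtain ⟨v, hv⟩ := heq.symm.exists_realize (φ := ∼φ.constantGerms)
    ⟨Sum.elim (↑) fun _ => a, by
      rw [Formula.realize_not, Formula.realize_constantGerms]
      rwa [hφs] at hN⟩
  rw [Formula.realize_not, Formula.realize_constantGerms] at hv
  exact hv (hasConstantGerms_iff.2 (hloc _ (φ.definable₁_setOf_realize _) _))
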